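/- Suppose $c_1=c_2=2$. For $\tilde\nu_q$-almost every $x\in[0,1]$, $\liminf_{n\to\infty}\frac{\log_2\tilde\nu_q(I_n(x))}{-n}=\min\{h(\tilde a),h(\tilde b)\}$ and $\limsup_{n\to\infty}\frac{\log_2\tilde\nu_q(I_n(x))}{-n}=\max\{h(\tilde a),h(\tilde b)\}$, where $h(\tilde a)=-\sum_{i=1}^2\tilde a_i\log_2\tilde a_i$ and $h(\tilde b)=-\sum_{j=1}^2\tilde b_j\log_2\tilde b_j$. -/

import Mathlib

open MeasureTheory Metric Set Filter Topology Classical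
open scoped ENNReal NNReal

noncomputable section

namespace MF

/-! ### Olsen's multifractal measures and dimension functions on a metric space -/

variable {X : Type} [MetricSpace X]

/-- The sum `∑ m(B(xᵢ,rᵢ))^q (2rᵢ)^t` associated with a countable family of centered balls. -/
def olsenSum [MeasurableSpace X] (m : Measure X) (q t : ℝ) {ι : Type}
    (c : ι → X) (r : ι → ℝ) : ℝ≥0∞ :=
  ∑' i, m (closedBall (c i) (r i)) ^ q * ENNReal.ofReal (2 * r i) ^ t

/-- `Olsen's 𝓗^{q,t}_{m,δ}`: infimum over countable centered `δ`-coverings of `E`. -/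
def Hdel [MeasurableSpace X] (m : Measure X) (q t δ : ℝ) (E : Set X) : ℝ≥0∞ :=
  ⨅ (ι : Type) (_ : Countable ι) (c : ι → X) (r : ι → ℝ)
    (_ : ∀ i, c i ∈ E) (_ : ∀ i, 0 < r i ∧ r i ≤ δ)
    (_ : E ⊆ ⋃ i, closedBall (c i) (r i)), olsenSum m q t c r

/-- Olsen's premeasure `𝓗̄^{q,t}_m` (limit, i.e. supremum, as `δ ↓ 0`). -/
def Hpre [MeasurableSpace X] (m : Measure X) (q t : ℝ) (E : Set X) : ℝ≥0∞ :=
  ⨆ (δ : ℝ) (_ : 0 < δ), Hdel m q t δ E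

/-- Olsen's multifractal Hausdorff measure `𝓗^{q,t}_m`. -/
def Hmeas [MeasurableSpace X] (m : Measure X) (q t : ℝ) (E : Set X) : ℝ≥0∞ :=
  ⨆ (F : Set X) (_ : F ⊆ E), Hpre m q t F

/-- `𝓟̄^{q,t}_{m,δ}`: supremum over countable centered `δ`-packings of `E`. -/
def Pdel [MeasurableSpace X] (m : Measure X) (q t δ : ℝ) (E : Set X) : ℝ≥0∞ :=
  ⨆ (ι : Type) (_ : Countable ι) (c : ι → X) (r : ι → ℝ)
    (_ : ∀ i, c i ∈ E) (_ : ∀ i, 0 < r i ∧ r i ≤ δ)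
    (_ : ∀ i j, i ≠ j → Disjoint (closedBall (c i) (r i)) (closedBall (c j) (r j))),
    olsenSum m q t c r

/-- Olsen's packing premeasure `𝓟̄^{q,t}_m` (limit, i.e. infimum, as `δ ↓ 0`). -/
def Ppre [MeasurableSpace X] (m : Measure X) (q t : ℝ) (E : Set X) : ℝ≥0∞ :=
  ⨅ (δ : ℝ) (_ : 0 < δ), Pdel m q t δ E

/-- Olsen's multifractal packing measure `𝓟^{q,t}_m`. -/
def Pmeas [MeasurableSpace X] (m : Measure X) (q t : ℝ) (E : Set X) : ℝ≥0∞ :=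
  ⨅ (En : ℕ → Set X) (_ : E ⊆ ⋃ n, En n), ∑' n, Ppre m q t (En n)

/-- The (topological) support of a measure on a metric space. -/
def msupport [MeasurableSpace X] (m : Measure X) : Set X :=
  {x | ∀ r : ℝ, 0 < r → 0 < m (ball x r)}

/-- Olsen's multifractal Hausdorff dimension function `b_m`. -/
def bFun [MeasurableSpace X] (m : Measure X) (q : ℝ) : ℝ :=
  sInf {t | Hmeas m q t (msupport m) = 0}

/-- Olsen's multifractal packing dimension function `B_m`. -/
def BFun [MeasurableSpace X] (m : Measure X) (q : ℝ) : ℝ :=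
  sInf {t | Pmeas m q t (msupport m) = 0}

/-- Olsen's function `τ_m`. -/
def tauFun [MeasurableSpace X] (m : Measure X) (q : ℝ) : ℝ :=
  sInf {t | Ppre m q t (msupport m) = 0}

/-- `t`-dimensional packing pre-premeasure at scale `δ`. -/
def pPdel (t δ : ℝ) (E : Set X) : ℝ≥0∞ :=
  ⨆ (ι : Type) (_ : Countable ι) (c : ι → X) (r : ι → ℝ)
    (_ : ∀ i, c i ∈ E) (_ : ∀ i, 0 < r i ∧ r i ≤ δ)
    (_ : ∀ i j, i ≠ j → Disjoint (closedBall (c i) (r i)) (closedBall (c j) (r j))),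
    ∑' i, ENNReal.ofReal (2 * r i) ^ t

/-- `t`-dimensional packing premeasure. -/
def pPpre (t : ℝ) (E : Set X) : ℝ≥0∞ := ⨅ (δ : ℝ) (_ : 0 < δ), pPdel t δ E

/-- `t`-dimensional packing measure. -/
def pPmeas (t : ℝ) (E : Set X) : ℝ≥0∞ :=
  ⨅ (En : ℕ → Set X) (_ : E ⊆ ⋃ n, En n), ∑' n, pPpre t (En n)

/-- Packing dimension of a set. -/
def packDim (E : Set X) : ℝ := sInf {t | pPmeas t E = 0}

/-- The level set `X_m(α)` of points of the support where the local Hölder exponent is `α`. -/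
def Xlev [MeasurableSpace X] (m : Measure X) (α : ℝ) : Set X :=
  {x | x ∈ msupport m ∧
    Tendsto (fun r => Real.log (m (closedBall x r)).toReal / Real.log r)
      (𝓝[>] (0 : ℝ)) (𝓝 α)}

/-- Legendre transform `f^*(x) = inf_y (xy + f(y))`. -/
def leg (f : ℝ → ℝ) (x : ℝ) : ℝ := ⨅ y : ℝ, (x * y + f y)

/-! ### The mixed symbolic space and inhomogeneous multinomial measures -/

/-- `j` is an index governed by the first alphabet:
`T (2k-1) ≤ j < T (2k)` for some `k ≥ 1`. -/
def isA (T : ℕ → ℕ) (j : ℕ) : Prop :=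
  ∃ k, 1 ≤ k ∧ T (2 * k - 1) ≤ j ∧ j < T (2 * k)

/-- The size of the alphabet at (0-based) position `n`, i.e. at paper index `j = n+1`. -/
def Yc (c₁ c₂ : ℕ) (T : ℕ → ℕ) (n : ℕ) : ℕ := if isA T (n + 1) then c₁ else c₂

/-- The mixed symbolic space `∂𝒜₁,₂* = ∏ⱼ Yⱼ`. -/
abbrev Omg (c₁ c₂ : ℕ) (T : ℕ → ℕ) : Type := ∀ n : ℕ, Fin (Yc c₁ c₂ T n)

/-- Finite words of length `n`. -/
abbrev Word (c₁ c₂ : ℕ) (T : ℕ → ℕ) (n : ℕ) : Type :=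
  ∀ i : Fin n, Fin (Yc c₁ c₂ T i.val)

/-- `N_n`: the number of indices `1 ≤ j ≤ n` governed by the first alphabet. -/
def Ncount (T : ℕ → ℕ) (n : ℕ) : ℕ := ((Finset.Icc 1 n).filter (isA T)).card

/-- Diameter `c₁^{-N_n} c₂^{-(n-N_n)}` of a cylinder of generation `n`. -/
def Dw (c₁ c₂ : ℕ) (T : ℕ → ℕ) (n : ℕ) : ℝ :=
  ((c₁ : ℝ) ^ Ncount T n * (c₂ : ℝ) ^ (n - Ncount T n))⁻¹

/-- The cylinder `[w]` defined by a finite word `w`. -/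
def cyl (c₁ c₂ : ℕ) (T : ℕ → ℕ) (n : ℕ) (w : Word c₁ c₂ T n) : Set (Omg c₁ c₂ T) :=
  {x | ∀ i : Fin n, x i.val = w i}

/-- The mass `∏_{j≤n} p_j` given to the cylinder `[w]` by the inhomogeneous
multinomial measure with weights `a` and `b`. -/
def cylWeight (c₁ c₂ : ℕ) (T : ℕ → ℕ) (a b : ℕ → ℝ) (n : ℕ) (w : Word c₁ c₂ T n) : ℝ :=
  ∏ i : Fin n, (if isA T (i.val + 1) then a (w i).val else b (w i).val)

/-- `θ(q) = log_c (p₁^q + ⋯ + p_c^q)`. -/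
def theta (c : ℕ) (p : ℕ → ℝ) (q : ℝ) : ℝ :=
  Real.logb c (∑ i ∈ Finset.range c, p i ^ q)

/-- `τ_{μ,n}(q)`, defined by `∑_{z ∈ 𝒜₁,₂ⁿ} μ([z])^q = |w|^{-τ_{μ,n}(q)}`. -/
def tauN (c₁ c₂ : ℕ) (T : ℕ → ℕ) (a b : ℕ → ℝ) (q : ℝ) (n : ℕ) : ℝ :=
  Real.log (∑ z : Word c₁ c₂ T n, cylWeight c₁ c₂ T a b n z ^ q) /
    Real.log ((c₁ : ℝ) ^ Ncount T n * (c₂ : ℝ) ^ (n - Ncount T n))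

/-- The natural projection `γ : ∂𝒜₁,₂* → [0,1]`,
`γ(ε₁ε₂⋯) = ∑_{n≥1} εₙ c₁^{-N_n} c₂^{-(n-N_n)}`. -/
def gammaMap (c₁ c₂ : ℕ) (T : ℕ → ℕ) (x : Omg c₁ c₂ T) : ℝ :=
  ∑' n : ℕ, ((x n).val : ℝ) * Dw c₁ c₂ T (n + 1)

/-- The normalized weights `pᵢ^q / (p₁^q + ⋯ + p_c^q)`. -/
def taW (c : ℕ) (p : ℕ → ℝ) (q : ℝ) (i : ℕ) : ℝ :=
  p i ^ q / ∑ j ∈ Finset.range c, p j ^ q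

/-- `s₁ = min{max aᵢ, max bⱼ}`. -/
def sOne (c₁ c₂ : ℕ) (a b : ℕ → ℝ) : ℝ :=
  min (sSup {x | ∃ i < c₁, a i = x}) (sSup {x | ∃ j < c₂, b j = x})

/-- `s₂ = max{min aᵢ, min bⱼ}`. -/
def sTwo (c₁ c₂ : ℕ) (a b : ℕ → ℝ) : ℝ :=
  max (sInf {x | ∃ i < c₁, a i = x}) (sInf {x | ∃ j < c₂, b j = x})

/-- Entropy `h(p) = -∑_{i<2} pᵢ log₂ pᵢ`. -/
def hEnt (p : ℕ → ℝ) : ℝ := -(∑ i ∈ Finset.range 2, p i * Real.logb 2 (p i))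

/-! ### Dyadic intervals -/

/-- The family `𝓕_n` of dyadic intervals of generation `n` in `[0,1]`. -/
def Fnfam (n : ℕ) : Set (Set ℝ) :=
  {I | ∃ j : ℕ, j < 2 ^ n ∧ I = Set.Icc ((j : ℝ) / 2 ^ n) (((j : ℝ) + 1) / 2 ^ n)}

/-- Index of the dyadic interval of generation `n` containing `x`
(the left one when `x` is dyadic). -/
def dyadIdx (n : ℕ) (x : ℝ) : ℤ := ⌈x * 2 ^ n⌉ - 1

/-- `I_n(x)`: the dyadic interval of generation `n` containing `x`
(the left one when `x` is dyadic). -/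
def Idyad (n : ℕ) (x : ℝ) : Set ℝ :=
  Set.Icc ((dyadIdx n x : ℝ) / 2 ^ n) (((dyadIdx n x : ℝ) + 1) / 2 ^ n)

/-- `I_n(x)⁺`: the right neighbour of `I_n(x)` in `𝓕_n`. -/
def IdyadP (n : ℕ) (x : ℝ) : Set ℝ :=
  Set.Icc (((dyadIdx n x : ℝ) + 1) / 2 ^ n) (((dyadIdx n x : ℝ) + 2) / 2 ^ n)

/-- `I_n(x)⁻`: the left neighbour of `I_n(x)` in `𝓕_n`. -/
def IdyadM (n : ℕ) (x : ℝ) : Set ℝ :=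
  Set.Icc (((dyadIdx n x : ℝ) - 1) / 2 ^ n) ((dyadIdx n x : ℝ) / 2 ^ n)

/-! ### Averages and their lower and upper limits -/

/-- If a sequence takes the value `L` on most of the first `n k` indices, its averages along
`n k` tend to `L`. -/
lemma tendsto_average_of_eq_on_blocks {E : ℕ → ℝ} {L M : ℝ} (hM : ∀ i, |E i - L| ≤ M)
    {m n : ℕ → ℕ} (hm : ∀ k, 1 ≤ m k) (hmn : ∀ k, m k < n k)
    (hrat : Tendsto (fun k => (n k : ℝ) / m k) atTop atTop)
    (hE : ∀ k i, m k ≤ i → i + 1 < n k → E i = L) :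
    Tendsto (fun k => (∑ i ∈ Finset.range (n k), E i) / (n k : ℝ)) atTop (𝓝 L) := by
  have hM0 : 0 ≤ M := (abs_nonneg _).trans (hM 0)
  have key : ∀ k, |(∑ i ∈ Finset.range (n k), E i) / (n k : ℝ) - L|
      ≤ 2 * M * ((n k : ℝ) / m k)⁻¹ := by
    intro k
    have hn : (0 : ℝ) < n k := by exact_mod_cast (Nat.zero_le _).trans_lt (hmn k)
    have hmk : (1 : ℝ) ≤ m k := by exact_mod_cast hm k
    have h1 : (∑ i ∈ Finset.range (n k), E i) / (n k : ℝ) - L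
        = (∑ i ∈ Finset.range (n k), (E i - L)) / n k := by
      rw [Finset.sum_sub_distrib]
      simp only [Finset.sum_const, Finset.card_range, nsmul_eq_mul]
      field_simp
    have h2 : |∑ i ∈ Finset.range (n k), (E i - L)| ≤ (m k + 1) * M := by
      calc |∑ i ∈ Finset.range (n k), (E i - L)|
          ≤ ∑ i ∈ Finset.range (n k), |E i - L| := Finset.abs_sum_le_sum_abs _ _
        _ ≤ ∑ i ∈ Finset.range (n k), if i ∈ insert (n k - 1) (Finset.range (m k)) then M else 0 := by
            refine Finset.sum_le_sum fun i hi => ?_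
            split_ifs with h
            · exact hM i
            · simp only [Finset.mem_insert, Finset.mem_range, not_or, not_lt] at h hi
              rw [hE k i h.2 (by omega)]
              simp
        _ = ((Finset.range (n k)).filter
              (· ∈ insert (n k - 1) (Finset.range (m k)))).card * M := by
            rw [← Finset.sum_filter, Finset.sum_const, nsmul_eq_mul]
        _ ≤ (m k + 1) * M := by
            gcongr
            have : ((Finset.range (n k)).filter
              (· ∈ insert (n k - 1) (Finset.range (m k)))).card ≤ m k + 1 := by
              refine (Finset.card_le_card (t := insert (n k - 1) (Finset.range (m k))) ?_).trans ?_
              · intro i hi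
                exact (Finset.mem_filter.1 hi).2
              · exact (Finset.card_insert_le _ _).trans (by simp)
            exact_mod_cast this
    rw [h1, abs_div, abs_of_pos hn, inv_div, ← mul_div_assoc]
    gcongr
    nlinarith
  have hlim : Tendsto (fun k => 2 * M * ((n k : ℝ) / m k)⁻¹) atTop (𝓝 0) := by
    simpa using (tendsto_inv_atTop_zero.comp hrat).const_mul (2 * M)
  rw [tendsto_iff_dist_tendsto_zero]
  exact squeeze_zero (fun _ => dist_nonneg) (fun k => by rw [Real.dist_eq]; exact key k) hlim

lemma liminf_eq_of_tendsto_subseq {u e : ℕ → ℝ} {L C : ℝ} (he : Tendsto e atTop (𝓝 0))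
    (hlow : ∀ᶠ n in atTop, L + e n ≤ u n) (hup : ∀ᶠ n in atTop, u n ≤ C)
    {φ : ℕ → ℕ} (hφ : Tendsto φ atTop atTop) (hu : Tendsto (u ∘ φ) atTop (𝓝 L)) :
    liminf u atTop = L := by
  have hb : ∀ ε > 0, ∀ᶠ n in atTop, L - ε ≤ u n := fun ε hε => by
    filter_upwards [hlow, he.eventually (lt_mem_nhds (neg_lt_zero.2 hε))] with n h1 h2
    linarith
  have hbdd : IsBoundedUnder (· ≥ ·) atTop u := ⟨L - 1, by simpa using hb 1 one_pos⟩
  have hcob : IsCoboundedUnder (· ≥ ·) atTop u :=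
    IsBoundedUnder.isCoboundedUnder_ge ⟨C, by simpa using hup⟩
  refine le_antisymm (le_of_forall_pos_le_add fun ε hε => ?_)
    (le_of_forall_sub_le fun ε hε => le_liminf_of_le hcob (hb ε hε))
  refine liminf_le_of_frequently_le (hφ.frequently (Eventually.frequently ?_)) hbdd
  filter_upwards [hu.eventually (gt_mem_nhds (lt_add_of_pos_right L hε))] with k hk
  exact hk.le

lemma limsup_eq_of_tendsto_subseq {u e : ℕ → ℝ} {L C : ℝ} (he : Tendsto e atTop (𝓝 0))
    (hup : ∀ᶠ n in atTop, u n ≤ L + e n) (hlow : ∀ᶠ n in atTop, C ≤ u n)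
    {φ : ℕ → ℕ} (hφ : Tendsto φ atTop atTop) (hu : Tendsto (u ∘ φ) atTop (𝓝 L)) :
    limsup u atTop = L := by
  have hb : ∀ ε > 0, ∀ᶠ n in atTop, u n ≤ L + ε := fun ε hε => by
    filter_upwards [hup, he.eventually (gt_mem_nhds hε)] with n h1 h2
    linarith
  have hbdd : IsBoundedUnder (· ≤ ·) atTop u := ⟨L + 1, by simpa using hb 1 one_pos⟩
  have hcob : IsCoboundedUnder (· ≤ ·) atTop u :=
    IsBoundedUnder.isCoboundedUnder_le ⟨C, by simpa using hlow⟩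
  refine le_antisymm (le_of_forall_pos_le_add fun ε hε => limsup_le_of_le hcob (hb ε hε))
    (le_of_forall_sub_le fun ε hε => ?_)
  refine le_limsup_of_frequently_le (hφ.frequently (Eventually.frequently ?_)) hbdd
  filter_upwards [hu.eventually (lt_mem_nhds (sub_lt_self L hε))] with k hk
  exact hk.le

/-! ### A strong law for bounded independent variables -/

lemma ae_eventually_sum_lt_of_hasSubgaussianMGF {Ω : Type*} [MeasurableSpace Ω] {μ : Measure Ω}
    [IsProbabilityMeasure μ] {Y : ℕ → Ω → ℝ} (hY : ProbabilityTheory.iIndepFun Y μ) {c : ℝ≥0}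
    (hc : 0 < c) (hsub : ∀ i, ProbabilityTheory.HasSubgaussianMGF (Y i) c μ) {ε : ℝ}
    (hε : 0 < ε) :
    ∀ᵐ ω ∂μ, ∀ᶠ n : ℕ in atTop, ∑ i ∈ Finset.range n, Y i ω < ε * n := by
  set r : ℝ := Real.exp (-(ε ^ 2 / (2 * c))) with hr
  have hr1 : r < 1 := by
    rw [hr, Real.exp_lt_one_iff, neg_lt_zero]
    positivity
  have hbound : ∀ n : ℕ, μ {ω | ε * n ≤ ∑ i ∈ Finset.range n, Y i ω} ≤ ENNReal.ofReal (r ^ n) := by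
    intro n
    have h := ProbabilityTheory.HasSubgaussianMGF.measure_sum_range_ge_le_of_iIndepFun hY
      (n := n) (fun i _ => hsub i) (ε := ε * n) (by positivity)
    rw [← ENNReal.ofReal_toReal (measure_ne_top μ _)]
    refine ENNReal.ofReal_le_ofReal (h.trans_eq ?_)
    rw [hr, ← Real.exp_nat_mul]
    congr 1
    rcases Nat.eq_zero_or_pos n with rfl | hn
    · simp
    · have : (n : ℝ) ≠ 0 := by positivity
      have : (c : ℝ) ≠ 0 := by positivity
      field_simp
  have hsum : ∑' n : ℕ, μ {ω | ε * n ≤ ∑ i ∈ Finset.range n, Y i ω} ≠ ∞ := by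
    refine ne_top_of_le_ne_top ?_ (ENNReal.tsum_le_tsum hbound)
    exact (summable_geometric_of_lt_one (Real.exp_pos _).le hr1).tsum_ofReal_ne_top
  filter_upwards [ae_eventually_notMem hsum] with ω hω
  filter_upwards [hω] with n hn
  exact not_le.1 hn

lemma ae_tendsto_average_sub_integral {Ω : Type*} [MeasurableSpace Ω] {μ : Measure Ω}
    [IsProbabilityMeasure μ] {X : ℕ → Ω → ℝ} (hX : ProbabilityTheory.iIndepFun X μ)
    (hm : ∀ i, Measurable (X i)) {C : ℝ} (hC : 0 < C) (hb : ∀ i ω, X i ω ∈ Set.Icc 0 C) :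
    ∀ᵐ ω ∂μ, Tendsto (fun n : ℕ => (∑ i ∈ Finset.range n, (X i ω - ∫ x, X i x ∂μ)) / (n : ℝ))
      atTop (𝓝 0) := by
  set c : ℝ≥0 := (‖C - 0‖₊ / 2) ^ 2 with hcdef
  have hc : 0 < c := by
    have : (0 : ℝ≥0) < ‖C - 0‖₊ := by simpa using hC.ne'
    positivity
  have hsub : ∀ i, ProbabilityTheory.HasSubgaussianMGF (fun ω => X i ω - ∫ x, X i x ∂μ) c μ :=
    fun i => ProbabilityTheory.hasSubgaussianMGF_of_mem_Icc (hm i).aemeasurable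
      (ae_of_all _ (hb i))
  have hind : ProbabilityTheory.iIndepFun (fun i ω => X i ω - ∫ x, X i x ∂μ) μ :=
    hX.comp (fun i t => t - ∫ x, X i x ∂μ) fun i => by fun_prop
  have hind' : ProbabilityTheory.iIndepFun (fun i ω => -(X i ω - ∫ x, X i x ∂μ)) μ :=
    hX.comp (fun i t => -(t - ∫ x, X i x ∂μ)) fun i => by fun_prop
  have h1 : ∀ᵐ ω ∂μ, ∀ k : ℕ, ∀ᶠ n : ℕ in atTop,
      ∑ i ∈ Finset.range n, (X i ω - ∫ x, X i x ∂μ) < 1 / ((k : ℝ) + 1) * n :=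
    ae_all_iff.2 fun k => ae_eventually_sum_lt_of_hasSubgaussianMGF hind hc hsub (by positivity)
  have h2 : ∀ᵐ ω ∂μ, ∀ k : ℕ, ∀ᶠ n : ℕ in atTop,
      ∑ i ∈ Finset.range n, -(X i ω - ∫ x, X i x ∂μ) < 1 / ((k : ℝ) + 1) * n :=
    ae_all_iff.2 fun k => ae_eventually_sum_lt_of_hasSubgaussianMGF hind' hc
      (fun i => (hsub i).neg) (by positivity)
  filter_upwards [h1, h2] with ω h1 h2
  rw [Metric.tendsto_atTop']
  intro ε hε
  obtain ⟨k, hk⟩ := exists_nat_one_div_lt hε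
  obtain ⟨N, hN⟩ := eventually_atTop.1 ((h1 k).and (h2 k))
  refine ⟨N, fun n hn => ?_⟩
  obtain ⟨ha, hb⟩ := hN n hn.le
  have hn0 : (0 : ℝ) < n := by exact_mod_cast (Nat.zero_le _).trans_lt hn
  rw [Finset.sum_neg_distrib] at hb
  rw [Real.dist_eq, sub_zero, abs_div, abs_of_pos hn0, div_lt_iff₀ hn0, abs_lt]
  have : 1 / ((k : ℝ) + 1) * n < ε * n := by gcongr
  constructor <;> linarith

/-! ### Binary digits and the projection `γ` -/

lemma Yc_two_two (T : ℕ → ℕ) (n : ℕ) : Yc 2 2 T n = 2 := by simp [Yc]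

lemma sum_fin_Yc_two_two {M : Type*} [AddCommMonoid M] (T : ℕ → ℕ) (n : ℕ) (f : ℕ → M) :
    ∑ i : Fin (Yc 2 2 T n), f i.val = ∑ i ∈ Finset.range 2, f i := by
  rw [Fin.sum_univ_eq_sum_range (fun i => f i), Yc_two_two]

lemma digit_lt_two {T : ℕ → ℕ} (x : Omg 2 2 T) (n : ℕ) : (x n).val < 2 :=
  (x n).isLt.trans_eq (Yc_two_two T n)

lemma Dw_two_two (T : ℕ → ℕ) (n : ℕ) : Dw 2 2 T n = ((2 : ℝ) ^ n)⁻¹ := by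
  have h : Ncount T n ≤ n := by
    simpa [Ncount] using Finset.card_filter_le (Finset.Icc 1 n) (isA T)
  rw [Dw, Nat.cast_ofNat, ← pow_add, Nat.add_sub_cancel' h]

/-- The integer whose binary expansion is `x 0, …, x (n - 1)`. -/
def digitPrefix {T : ℕ → ℕ} (x : Omg 2 2 T) : ℕ → ℕ
  | 0 => 0
  | n + 1 => 2 * digitPrefix x n + (x n).val

lemma digitPrefix_congr {T : ℕ → ℕ} {x y : Omg 2 2 T} {n : ℕ} (h : ∀ i < n, x i = y i) :
    digitPrefix x n = digitPrefix y n := by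
  induction n with
  | zero => rfl
  | succ n ih =>
    rw [digitPrefix, digitPrefix, ih fun i hi => h i (by omega), h n (by omega)]

lemma eq_of_digitPrefix_eq {T : ℕ → ℕ} {x y : Omg 2 2 T} {n : ℕ}
    (h : digitPrefix x n = digitPrefix y n) : ∀ i < n, x i = y i := by
  induction n with
  | zero => intro i hi; omega
  | succ n ih =>
    have hx := digit_lt_two x n
    have hy := digit_lt_two y n
    rw [digitPrefix, digitPrefix] at h
    intro i hi
    rcases Nat.lt_succ_iff_lt_or_eq.1 hi with hi | rfl
    · exact ih (by omega) i hi
    · exact Fin.ext (by omega)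

lemma sum_digits_eq_digitPrefix_div {T : ℕ → ℕ} (x : Omg 2 2 T) (n : ℕ) :
    ∑ i ∈ Finset.range n, ((x i).val : ℝ) * Dw 2 2 T (i + 1) = digitPrefix x n / 2 ^ n := by
  induction n with
  | zero => simp [digitPrefix]
  | succ n ih =>
    rw [Finset.sum_range_succ, ih, Dw_two_two, digitPrefix]
    push_cast
    field_simp
    ring

lemma tendsto_digitPrefix_div {T : ℕ → ℕ} (x : Omg 2 2 T) :
    Tendsto (fun n => (digitPrefix x n : ℝ) / 2 ^ n) atTop (𝓝 (gammaMap 2 2 T x)) := by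
  have hs : Summable fun n => ((x n).val : ℝ) * Dw 2 2 T (n + 1) := by
    refine Summable.of_nonneg_of_le (fun n => ?_) (fun n => ?_)
      (summable_geometric_of_lt_one (r := (1 / 2 : ℝ)) (by norm_num) (by norm_num))
    · rw [Dw_two_two]; positivity
    · have h : ((x n).val : ℝ) ≤ 1 := by exact_mod_cast Nat.lt_succ_iff.1 (digit_lt_two x n)
      rw [Dw_two_two, one_div, inv_pow]
      calc ((x n).val : ℝ) * ((2 : ℝ) ^ (n + 1))⁻¹ ≤ 1 * ((2 : ℝ) ^ n)⁻¹ := by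
            gcongr <;> norm_num
        _ = _ := one_mul _
  have h := hs.hasSum.tendsto_sum_nat
  simp only [sum_digits_eq_digitPrefix_div] at h
  exact h

lemma digitPrefix_add_bounds {T : ℕ → ℕ} (x : Omg 2 2 T) (n k : ℕ) :
    digitPrefix x n * 2 ^ k ≤ digitPrefix x (n + k) ∧
      digitPrefix x (n + k) + 1 ≤ (digitPrefix x n + 1) * 2 ^ k := by
  induction k with
  | zero => simp
  | succ k ih =>
    have := digit_lt_two x (n + k)
    rw [← add_assoc, digitPrefix, pow_succ]
    constructor <;> nlinarith [ih.1, ih.2]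

lemma gammaMap_mem_Icc {T : ℕ → ℕ} (x : Omg 2 2 T) (n : ℕ) :
    gammaMap 2 2 T x ∈ Set.Icc ((digitPrefix x n : ℝ) / 2 ^ n) ((digitPrefix x n + 1) / 2 ^ n) := by
  have hev : ∀ᶠ m in atTop, (digitPrefix x m : ℝ) / 2 ^ m ∈
      Set.Icc ((digitPrefix x n : ℝ) / 2 ^ n) ((digitPrefix x n + 1) / 2 ^ n) := by
    filter_upwards [eventually_ge_atTop n] with m hm
    obtain ⟨k, rfl⟩ := Nat.exists_eq_add_of_le hm
    obtain ⟨h1, h2⟩ := digitPrefix_add_bounds x n k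
    have h1' : (digitPrefix x n : ℝ) * 2 ^ k ≤ digitPrefix x (n + k) := by exact_mod_cast h1
    have h2' : (digitPrefix x (n + k) : ℝ) + 1 ≤ (digitPrefix x n + 1) * 2 ^ k := by
      exact_mod_cast h2
    have hn : (0 : ℝ) < 2 ^ n := by positivity
    rw [pow_add]
    constructor
    · rw [div_le_div_iff₀ (by positivity) (by positivity)]
      nlinarith
    · rw [div_le_div_iff₀ (by positivity) (by positivity)]
      nlinarith
  exact isClosed_Icc.mem_of_tendsto (tendsto_digitPrefix_div x) hev

lemma measurable_digitPrefix {T : ℕ → ℕ} (n : ℕ) :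
    Measurable fun x : Omg 2 2 T => digitPrefix x n := by
  induction n with
  | zero => exact measurable_const
  | succ n ih =>
    simp only [digitPrefix]
    exact (ih.const_mul 2).add ((measurable_of_countable Fin.val).comp (measurable_pi_apply n))

lemma measurable_gammaMap (T : ℕ → ℕ) : Measurable (gammaMap 2 2 T) := by
  refine measurable_of_tendsto_metrizable
    (f := fun n (x : Omg 2 2 T) => (digitPrefix x n : ℝ) / 2 ^ n) (fun n => ?_)
    (tendsto_pi_nhds.2 tendsto_digitPrefix_div)
  exact ((measurable_of_countable (fun k : ℕ => (k : ℝ))).comp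
    (measurable_digitPrefix n)).div_const _

/-- The cylinder of generation `n` around `x`. -/
lemma cyl_self_eq {T : ℕ → ℕ} (x : Omg 2 2 T) (n : ℕ) :
    cyl 2 2 T n (fun i => x i.val) = {y | digitPrefix y n = digitPrefix x n} := by
  ext y
  exact ⟨fun h => digitPrefix_congr fun i hi => h ⟨i, hi⟩,
    fun h i => eq_of_digitPrefix_eq h i.val i.isLt⟩

lemma dyadIdx_gammaMap {T : ℕ → ℕ} {x : Omg 2 2 T} {n : ℕ}
    (hx : ∀ k : ℤ, gammaMap 2 2 T x ≠ k / 2 ^ n) :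
    dyadIdx n (gammaMap 2 2 T x) = digitPrefix x n := by
  obtain ⟨h1, h2⟩ := gammaMap_mem_Icc x n
  rw [div_le_iff₀ (by positivity)] at h1
  rw [le_div_iff₀ (by positivity)] at h2
  have h3 : (digitPrefix x n : ℝ) < gammaMap 2 2 T x * 2 ^ n := by
    refine lt_of_le_of_ne h1 fun h => hx (digitPrefix x n) ?_
    rw [eq_div_iff (by positivity), ← h]
    simp
  rw [dyadIdx, sub_eq_iff_eq_add, Int.ceil_eq_iff]
  push_cast
  constructor <;> linarith

/-- Away from dyadic points, the preimage under `γ` of a dyadic interval is a cylinder. -/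
lemma gammaMap_mem_Idyad_iff {T : ℕ → ℕ} {x y : Omg 2 2 T} {n : ℕ}
    (hx : ∀ k : ℤ, gammaMap 2 2 T x ≠ k / 2 ^ n) (hy : ∀ k : ℤ, gammaMap 2 2 T y ≠ k / 2 ^ n) :
    gammaMap 2 2 T y ∈ Idyad n (gammaMap 2 2 T x) ↔ digitPrefix y n = digitPrefix x n := by
  rw [Idyad, dyadIdx_gammaMap hx]
  constructor
  · rintro ⟨h1, h2⟩
    have h1 := lt_of_le_of_ne h1 fun h => hy _ h.symm
    rw [div_lt_iff₀ (by positivity)] at h1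
    rw [le_div_iff₀ (by positivity)] at h2
    have h := dyadIdx_gammaMap hy
    rw [dyadIdx, sub_eq_iff_eq_add, Int.ceil_eq_iff] at h
    push_cast at h h1 h2
    have ha : (digitPrefix y n : ℝ) < digitPrefix x n + 1 := by linarith [h.1]
    have hb : (digitPrefix x n : ℝ) < digitPrefix y n + 1 := by linarith [h.2]
    have ha' : digitPrefix y n < digitPrefix x n + 1 := by exact_mod_cast ha
    have hb' : digitPrefix x n < digitPrefix y n + 1 := by exact_mod_cast hb
    omega
  · intro h
    have := gammaMap_mem_Icc y n
    rw [h] at this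
    simpa only [Int.cast_natCast] using this

/-! ### Inhomogeneous Bernoulli measures -/

/-- The weights at (0-based) position `n`. -/
def siteWeight (T : ℕ → ℕ) (a b : ℕ → ℝ) (n i : ℕ) : ℝ := if isA T (n + 1) then a i else b i

/-- The one-site measure at (0-based) position `n`. -/
def siteMeasure (T : ℕ → ℕ) (a b : ℕ → ℝ) (n : ℕ) : Measure (Fin (Yc 2 2 T n)) :=
  ∑ i, ENNReal.ofReal (siteWeight T a b n i.val) • Measure.dirac i

lemma siteMeasure_singleton (T : ℕ → ℕ) (a b : ℕ → ℝ) (n : ℕ) (i : Fin (Yc 2 2 T n)) :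
    siteMeasure T a b n {i} = ENNReal.ofReal (siteWeight T a b n i.val) := by
  simp [siteMeasure, Measure.finsetSum_apply, Set.indicator_apply]

/-- Weights on `{0, 1}` bounded below by `δ > 0` and of total mass one. -/
structure IsWeight (δ : ℝ) (p : ℕ → ℝ) : Prop where
  le : ∀ i < 2, δ ≤ p i
  sum_eq_one : ∑ i ∈ Finset.range 2, p i = 1

lemma IsWeight.le_one_sub {δ : ℝ} {p : ℕ → ℝ} (h : IsWeight δ p) {i : ℕ} (hi : i < 2) :
    p i ≤ 1 - δ := by
  have h0 := h.le 0 (by norm_num)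
  have h1 := h.le 1 (by norm_num)
  have hs := h.sum_eq_one
  rw [Finset.sum_range_succ, Finset.sum_range_one] at hs
  interval_cases i <;> linarith

lemma isWeight_siteWeight {δ : ℝ} {a b : ℕ → ℝ} (ha : IsWeight δ a) (hb : IsWeight δ b)
    (T : ℕ → ℕ) (n : ℕ) : IsWeight δ (siteWeight T a b n) := by
  by_cases h : isA T (n + 1)
  · have : siteWeight T a b n = a := funext fun i => by simp [siteWeight, h]
    rwa [this]
  · have : siteWeight T a b n = b := funext fun i => by simp [siteWeight, h]
    rwa [this]

lemma exists_isWeight_taW {a : ℕ → ℝ} (ha : ∀ i, i < 2 → 0 < a i ∧ a i < 1) (q : ℝ) :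
    ∃ δ > 0, IsWeight δ (taW 2 a q) := by
  have hpos : ∀ i < 2, 0 < a i ^ q := fun i hi => Real.rpow_pos_of_pos (ha i hi).1 q
  have hS : 0 < ∑ j ∈ Finset.range 2, a j ^ q :=
    Finset.sum_pos (fun i hi => hpos i (Finset.mem_range.1 hi)) (by simp)
  have ht : ∀ i < 2, 0 < taW 2 a q i := fun i hi => div_pos (hpos i hi) hS
  refine ⟨min (taW 2 a q 0) (taW 2 a q 1), lt_min (ht 0 (by norm_num)) (ht 1 (by norm_num)), ?_, ?_⟩
  · intro i hi
    interval_cases i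
    · exact min_le_left _ _
    · exact min_le_right _ _
  · simp only [taW]
    rw [← Finset.sum_div, div_self hS.ne']

lemma IsWeight.mono {δ δ' : ℝ} {p : ℕ → ℝ} (h : IsWeight δ p) (hδ : δ' ≤ δ) : IsWeight δ' p :=
  ⟨fun i hi => hδ.trans (h.le i hi), h.sum_eq_one⟩

lemma isProbabilityMeasure_siteMeasure {δ : ℝ} (hδ : 0 < δ) {a b : ℕ → ℝ} (ha : IsWeight δ a)
    (hb : IsWeight δ b) (T : ℕ → ℕ) (n : ℕ) : IsProbabilityMeasure (siteMeasure T a b n) := by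
  have h := isWeight_siteWeight ha hb T n
  refine ⟨?_⟩
  simp only [siteMeasure, Measure.finsetSum_apply, Measure.smul_apply, measure_univ, smul_eq_mul,
    mul_one]
  rw [sum_fin_Yc_two_two T n fun i => ENNReal.ofReal (siteWeight T a b n i),
    ← ENNReal.ofReal_sum_of_nonneg fun i hi => (hδ.le.trans (h.le i (Finset.mem_range.1 hi))),
    h.sum_eq_one, ENNReal.ofReal_one]

lemma integral_siteMeasure {δ : ℝ} (hδ : 0 < δ) {a b : ℕ → ℝ} (ha : IsWeight δ a)
    (hb : IsWeight δ b) (T : ℕ → ℕ) (n : ℕ) (f : ℕ → ℝ) :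
    ∫ i, f i.val ∂(siteMeasure T a b n) =
      ∑ i ∈ Finset.range 2, siteWeight T a b n i * f i := by
  have := isProbabilityMeasure_siteMeasure hδ ha hb T n
  rw [integral_fintype Integrable.of_finite, ← sum_fin_Yc_two_two T n]
  refine Finset.sum_congr rfl fun i _ => ?_
  rw [measureReal_def, siteMeasure_singleton, ENNReal.toReal_ofReal, smul_eq_mul]
  exact hδ.le.trans ((isWeight_siteWeight ha hb T n).le _ (i.isLt.trans_eq (Yc_two_two T n)))

/-- A measure with the cylinder weights of a product of one-site measures is that product. -/
lemma eq_infinitePi_siteMeasure {δ : ℝ} (hδ : 0 < δ) {T : ℕ → ℕ} {a b : ℕ → ℝ}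
    (ha : IsWeight δ a) (hb : IsWeight δ b)
    [∀ n, IsProbabilityMeasure (siteMeasure T a b n)] {μ : Measure (Omg 2 2 T)}
    (hμ : ∀ (n : ℕ) (w : Word 2 2 T n),
      μ (cyl 2 2 T n w) = ENNReal.ofReal (cylWeight 2 2 T a b n w)) :
    μ = Measure.infinitePi (siteMeasure T a b) := by
  have hcyl : ∀ (n : ℕ) (w : Word 2 2 T n),
      μ (cyl 2 2 T n w) = Measure.infinitePi (siteMeasure T a b) (cyl 2 2 T n w) := by
    intro n w
    have hset : cyl 2 2 T n w = Set.pi (Finset.range n : Set ℕ)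
        (fun i => if h : i < n then ({w ⟨i, h⟩} : Set (Fin (Yc 2 2 T i))) else Set.univ) := by
      ext x
      simp only [cyl, Set.mem_ofPred_eq, Set.mem_pi, Finset.coe_range, Set.mem_Iio]
      constructor
      · intro h i hi
        simpa [hi] using h ⟨i, hi⟩
      · intro h i
        simpa using h i.val i.isLt
    rw [hμ, hset, Measure.infinitePi_pi _ fun i _ => MeasurableSet.of_discrete, cylWeight,
      ENNReal.ofReal_prod_of_nonneg, Finset.prod_range]
    · refine Finset.prod_congr rfl fun i _ => ?_
      simp only [i.isLt, dif_pos, siteMeasure_singleton, siteWeight]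
    · intro i _
      exact hδ.le.trans ((isWeight_siteWeight ha hb T i.val).le _
        ((w i).isLt.trans_eq (Yc_two_two T i.val)))
  have hrestr : ∀ n, μ.map (fun (x : Omg 2 2 T) (i : Fin n) => x i.val) =
      (Measure.infinitePi (siteMeasure T a b)).map (fun (x : Omg 2 2 T) (i : Fin n) => x i.val) := by
    intro n
    have hmeas : Measurable (fun (x : Omg 2 2 T) (i : Fin n) => x i.val) := by fun_prop
    refine Measure.ext_of_singleton fun w => ?_
    rw [Measure.map_apply hmeas (measurableSet_singleton w),
      Measure.map_apply hmeas (measurableSet_singleton w)]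
    have : (fun (x : Omg 2 2 T) (i : Fin n) => x i.val) ⁻¹' {w} = cyl 2 2 T n w := by
      ext x
      simp [cyl, funext_iff]
    rw [this, hcyl]
  refine Measure.eq_infinitePi _ fun s t ht => ?_
  rw [← Measure.infinitePi_pi _ fun i _ => ht i]
  set n := s.sup id + 1 with hn
  have hlt : ∀ i ∈ s, i < n := fun i hi => Nat.lt_succ_iff.2 (Finset.le_sup (f := id) hi)
  have hmeas : Measurable (fun (x : Omg 2 2 T) (i : Fin n) => x i.val) := by fun_prop
  have hset : Set.pi (s : Set ℕ) t = (fun (x : Omg 2 2 T) (i : Fin n) => x i.val) ⁻¹'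
      {w : Word 2 2 T n | ∀ i : Fin n, i.val ∈ s → w i ∈ t i.val} := by
    ext x
    simp only [Set.mem_pi, Finset.mem_coe, Set.mem_preimage, Set.mem_ofPred_eq]
    exact ⟨fun h i hi => h i.val hi, fun h i hi => h ⟨i, hlt i hi⟩ hi⟩
  rw [hset, ← Measure.map_apply hmeas MeasurableSet.of_discrete, hrestr,
    Measure.map_apply hmeas MeasurableSet.of_discrete]

/-- A cylinder of generation `n` has mass at most `(1 - δ) ^ n`. -/
lemma measure_digitPrefix_eq_le {δ : ℝ} (hδ : 0 < δ) {T : ℕ → ℕ} {a b : ℕ → ℝ}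
    (ha : IsWeight δ a) (hb : IsWeight δ b) {μ : Measure (Omg 2 2 T)}
    (hμ : ∀ (n : ℕ) (w : Word 2 2 T n),
      μ (cyl 2 2 T n w) = ENNReal.ofReal (cylWeight 2 2 T a b n w)) (n k : ℕ) :
    μ {y | digitPrefix y n = k} ≤ ENNReal.ofReal ((1 - δ) ^ n) := by
  by_cases h : ∃ x : Omg 2 2 T, digitPrefix x n = k
  · obtain ⟨x, rfl⟩ := h
    rw [← cyl_self_eq, hμ]
    refine ENNReal.ofReal_le_ofReal ?_
    calc cylWeight 2 2 T a b n (fun i => x i.val) ≤ ∏ _i : Fin n, (1 - δ) := by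
          refine Finset.prod_le_prod (fun i _ => ?_) (fun i _ => ?_)
          · exact hδ.le.trans ((isWeight_siteWeight ha hb T i.val).le _ (digit_lt_two x i.val))
          · exact (isWeight_siteWeight ha hb T i.val).le_one_sub (digit_lt_two x i.val)
      _ = (1 - δ) ^ n := by simp
  · have : {y : Omg 2 2 T | digitPrefix y n = k} = ∅ := by
      ext y
      simpa using fun hy => h ⟨y, hy⟩
    simp [this]

lemma measure_gammaMap_eq_zero {δ : ℝ} (hδ : 0 < δ) {T : ℕ → ℕ} {a b : ℕ → ℝ}
    (ha : IsWeight δ a) (hb : IsWeight δ b) {μ : Measure (Omg 2 2 T)}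
    (hμ : ∀ (n : ℕ) (w : Word 2 2 T n),
      μ (cyl 2 2 T n w) = ENNReal.ofReal (cylWeight 2 2 T a b n w)) (d : ℝ) :
    μ {y | gammaMap 2 2 T y = d} = 0 := by
  have hδ1 : δ ≤ 1 - δ := (ha.le 0 (by norm_num)).trans (ha.le_one_sub (by norm_num))
  have hb : ∀ n : ℕ, μ {y | gammaMap 2 2 T y = d} ≤ 2 * ENNReal.ofReal ((1 - δ) ^ n) := by
    intro n
    have hsub : {y : Omg 2 2 T | gammaMap 2 2 T y = d} ⊆
        {y | digitPrefix y n = ⌊d * 2 ^ n⌋₊} ∪ {y | digitPrefix y n = ⌊d * 2 ^ n⌋₊ - 1} := by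
      rintro y rfl
      obtain ⟨h1, h2⟩ := gammaMap_mem_Icc y n
      rw [div_le_iff₀ (by positivity)] at h1
      rw [le_div_iff₀ (by positivity)] at h2
      have h3 : digitPrefix y n ≤ ⌊gammaMap 2 2 T y * 2 ^ n⌋₊ := Nat.le_floor h1
      have h4 : ⌊gammaMap 2 2 T y * 2 ^ n⌋₊ ≤ digitPrefix y n + 1 :=
        Nat.floor_le_of_le (by exact_mod_cast h2)
      simp only [Set.mem_union, Set.mem_ofPred_eq]
      omega
    refine (measure_mono hsub).trans ((measure_union_le _ _).trans ?_)
    rw [two_mul]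
    exact add_le_add (measure_digitPrefix_eq_le hδ ha hb hμ _ _)
      (measure_digitPrefix_eq_le hδ ha hb hμ _ _)
  have hlim : Tendsto (fun n : ℕ => 2 * ENNReal.ofReal ((1 - δ) ^ n)) atTop (𝓝 0) := by
    have h := ENNReal.tendsto_ofReal
      (tendsto_pow_atTop_nhds_zero_of_lt_one (by linarith : 0 ≤ 1 - δ) (by linarith))
    rw [ENNReal.ofReal_zero] at h
    simpa using ENNReal.Tendsto.const_mul h (Or.inr (by simp : (2 : ℝ≥0∞) ≠ ∞))
  exact le_antisymm (ge_of_tendsto' hlim hb) zero_le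

lemma ae_gammaMap_ne_dyadic {δ : ℝ} (hδ : 0 < δ) {T : ℕ → ℕ} {a b : ℕ → ℝ}
    (ha : IsWeight δ a) (hb : IsWeight δ b) {μ : Measure (Omg 2 2 T)}
    (hμ : ∀ (n : ℕ) (w : Word 2 2 T n),
      μ (cyl 2 2 T n w) = ENNReal.ofReal (cylWeight 2 2 T a b n w)) :
    ∀ᵐ x ∂μ, ∀ (n : ℕ) (k : ℤ), gammaMap 2 2 T x ≠ k / 2 ^ n := by
  refine ae_all_iff.2 fun n => ae_all_iff.2 fun k => ?_
  rw [ae_iff]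
  simpa using measure_gammaMap_eq_zero hδ ha hb hμ (k / 2 ^ n)

lemma logb_map_gammaMap_Idyad {δ : ℝ} (hδ : 0 < δ) {T : ℕ → ℕ} {a b : ℕ → ℝ}
    (ha : IsWeight δ a) (hb : IsWeight δ b) {μ : Measure (Omg 2 2 T)}
    (hμ : ∀ (n : ℕ) (w : Word 2 2 T n),
      μ (cyl 2 2 T n w) = ENNReal.ofReal (cylWeight 2 2 T a b n w))
    {x : Omg 2 2 T} {n : ℕ} (hx : ∀ k : ℤ, gammaMap 2 2 T x ≠ k / 2 ^ n) :
    Real.logb 2 (μ.map (gammaMap 2 2 T) (Idyad n (gammaMap 2 2 T x))).toReal =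
      ∑ i ∈ Finset.range n, Real.logb 2 (siteWeight T a b i (x i).val) := by
  have hpos : ∀ i, 0 < siteWeight T a b i (x i).val := fun i =>
    hδ.trans_le ((isWeight_siteWeight ha hb T i).le _ (digit_lt_two x i))
  have hmeas : μ.map (gammaMap 2 2 T) (Idyad n (gammaMap 2 2 T x)) =
      μ (cyl 2 2 T n fun i => x i.val) := by
    rw [Measure.map_apply (measurable_gammaMap T) (by exact measurableSet_Icc), cyl_self_eq]
    refine measure_congr ?_
    filter_upwards [ae_gammaMap_ne_dyadic hδ ha hb hμ] with y hy
    exact propext (gammaMap_mem_Idyad_iff hx (hy n))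
  have hw : cylWeight 2 2 T a b n (fun i => x i.val) =
      ∏ i ∈ Finset.range n, siteWeight T a b i (x i).val := by
    rw [Finset.prod_range]
    rfl
  rw [hmeas, hμ, hw, ENNReal.toReal_ofReal (Finset.prod_nonneg fun i _ => (hpos i).le),
    Real.logb_prod _ _ fun i _ => (hpos i).ne']

lemma measurable_logb_map_Idyad (ν : Measure ℝ) (n : ℕ) :
    Measurable fun x : ℝ => Real.logb 2 (ν (Idyad n x)).toReal / (-(n : ℝ)) := by
  have h : Measurable (dyadIdx n) :=
    (measurable_of_countable (fun k : ℤ => k - 1)).comp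
      (Int.measurable_ceil.comp (measurable_id.mul_const _))
  exact (measurable_of_countable fun j : ℤ => Real.logb 2
    (ν (Set.Icc ((j : ℝ) / 2 ^ n) (((j : ℝ) + 1) / 2 ^ n))).toReal / (-(n : ℝ))).comp h

/-- The entropy of the weights at (0-based) position `n`. -/
lemma hEnt_siteWeight (T : ℕ → ℕ) (a b : ℕ → ℝ) (n : ℕ) :
    hEnt (siteWeight T a b n) = if isA T (n + 1) then hEnt a else hEnt b := by
  split_ifs with h
  · exact congrArg hEnt (funext fun i => by simp [siteWeight, h])
  · exact congrArg hEnt (funext fun i => by simp [siteWeight, h])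

lemma ae_tendsto_average_information {δ : ℝ} (hδ : 0 < δ) {T : ℕ → ℕ} {a b : ℕ → ℝ}
    (ha : IsWeight δ a) (hb : IsWeight δ b) {μ : Measure (Omg 2 2 T)}
    (hμ : ∀ (n : ℕ) (w : Word 2 2 T n),
      μ (cyl 2 2 T n w) = ENNReal.ofReal (cylWeight 2 2 T a b n w)) :
    ∀ᵐ x ∂μ, Tendsto (fun n : ℕ => (∑ i ∈ Finset.range n,
      (-Real.logb 2 (siteWeight T a b i (x i).val) - hEnt (siteWeight T a b i))) / (n : ℝ))
      atTop (𝓝 0) := by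
  have hP := isProbabilityMeasure_siteMeasure hδ ha hb T
  have hμP := eq_infinitePi_siteMeasure hδ ha hb hμ
  subst hμP
  set f : ℕ → ℕ → ℝ := fun i j => -Real.logb 2 (siteWeight T a b i j) with hf
  have hδ1 : δ < 1 := by
    linarith [(ha.le 0 (by norm_num)).trans (ha.le_one_sub (by norm_num : 0 < 2))]
  have hlog : Real.logb 2 δ < 0 := Real.logb_neg (by norm_num) hδ hδ1
  have hmeas : ∀ i, Measurable fun j : Fin (Yc 2 2 T i) => f i j.val :=
    fun i => measurable_of_countable _
  have hint : ∀ i, ∫ x : Omg 2 2 T, f i (x i).val ∂(Measure.infinitePi (siteMeasure T a b)) =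
      hEnt (siteWeight T a b i) := by
    intro i
    rw [← integral_map (φ := fun x : Omg 2 2 T => x i) (f := fun j => f i j.val)
      (measurable_pi_apply i).aemeasurable (hmeas i).aestronglyMeasurable,
      Measure.infinitePi_map_eval, integral_siteMeasure hδ ha hb, hEnt]
    simp [hf]
  have h := ae_tendsto_average_sub_integral (C := -Real.logb 2 δ)
    (ProbabilityTheory.iIndepFun_infinitePi (P := siteMeasure T a b)
      (X := fun i j => f i j.val) hmeas)
    (fun i => (hmeas i).comp (measurable_pi_apply i)) (neg_pos.2 hlog) (fun i x => ?_)
  · simpa only [hint] using h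
  · have hw := isWeight_siteWeight ha hb T i
    have hle := hw.le _ (digit_lt_two x i)
    have hle1 := hw.le_one_sub (digit_lt_two x i)
    constructor
    · exact neg_nonneg.2 (Real.logb_nonpos (by norm_num) (hδ.le.trans hle) (by linarith))
    · exact neg_le_neg (Real.logb_le_logb_of_le (by norm_num) hδ hle)

/-! ### The blocks of the mixed symbolic space -/

lemma block_strictMono {T : ℕ → ℕ} (hTmono : ∀ k, 1 ≤ k → T k < T (k + 1)) :
    StrictMono fun k => T (k + 1) :=
  strictMono_nat_of_lt_succ fun k => hTmono (k + 1) (by omega)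

lemma isA_of_mem_odd_block {T : ℕ → ℕ} {k j : ℕ} (h1 : T (2 * k + 1) ≤ j)
    (h2 : j < T (2 * k + 2)) : isA T j :=
  ⟨k + 1, by omega, by simpa [mul_add] using h1, by simpa [mul_add] using h2⟩

lemma not_isA_of_mem_even_block {T : ℕ → ℕ} (hTmono : ∀ k, 1 ≤ k → T k < T (k + 1)) {k j : ℕ}
    (h1 : T (2 * k + 2) ≤ j) (h2 : j < T (2 * k + 3)) : ¬ isA T j := by
  rintro ⟨l, hl, h3, h4⟩
  have hlt : ∀ m n, T (m + 1) < T (n + 1) ↔ m < n :=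
    fun m n => (block_strictMono hTmono).lt_iff_lt
  have h5 := (hlt (2 * k + 1) (2 * l - 1)).1
    (by rw [show 2 * l - 1 + 1 = 2 * l by omega]; exact h1.trans_lt h4)
  have h6 := (hlt (2 * l - 2) (2 * k + 2)).1
    (by rw [show 2 * l - 2 + 1 = 2 * l - 1 by omega]; exact h3.trans_lt h2)
  omega

/-- Averages of a sequence that alternates between two values along the blocks approach each of
the two values along the ends of the corresponding blocks. -/
lemma tendsto_average_ite_isA {T : ℕ → ℕ} (hT1 : T 1 = 1) (hTmono : ∀ k, 1 ≤ k → T k < T (k + 1))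
    (hTrat : Tendsto (fun k => (T (k + 1) : ℝ) / (T k : ℝ)) atTop atTop) (u v : ℝ) :
    Tendsto (fun k => (∑ i ∈ Finset.range (T (2 * k + 2)), if isA T (i + 1) then u else v) /
      (T (2 * k + 2) : ℝ)) atTop (𝓝 u) ∧
    Tendsto (fun k => (∑ i ∈ Finset.range (T (2 * k + 3)), if isA T (i + 1) then u else v) /
      (T (2 * k + 3) : ℝ)) atTop (𝓝 v) := by
  have hone : ∀ k, 1 ≤ T (k + 1) := fun k => by
    simpa [hT1] using (block_strictMono hTmono).monotone (Nat.zero_le k)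
  constructor
  · refine tendsto_average_of_eq_on_blocks (M := |u - v|) (m := fun k => T (2 * k + 1))
      (fun i => ?_) (fun k => hone _) (fun k => hTmono _ (by omega))
      (hTrat.comp (tendsto_atTop_mono (fun k => (by omega : k ≤ 2 * k + 1)) tendsto_id))
      fun k i h1 h2 => if_pos (isA_of_mem_odd_block (k := k) (by omega) h2)
    split_ifs
    · simp
    · rw [abs_sub_comm]
  · refine tendsto_average_of_eq_on_blocks (M := |u - v|) (m := fun k => T (2 * k + 2))
      (fun i => ?_) (fun k => hone _) (fun k => hTmono _ (by omega))
      (hTrat.comp (tendsto_atTop_mono (fun k => (by omega : k ≤ 2 * k + 2)) tendsto_id))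
      fun k i h1 h2 => if_neg (not_isA_of_mem_even_block hTmono (k := k) (by omega) h2)
    split_ifs <;> simp

/-- strong law of large numbers for `ν̃_q`, `c₁ = c₂ = 2`. -/
theorem stmt17 (T : ℕ → ℕ) (hT1 : T 1 = 1) (hTmono : ∀ k, 1 ≤ k → T k < T (k + 1))
    (hTrat : Tendsto (fun k => (T (k + 1) : ℝ) / (T k : ℝ)) atTop atTop)
    (a b : ℕ → ℝ) (ha : ∀ i, i < 2 → 0 < a i ∧ a i < 1)
    (hb : ∀ j, j < 2 → 0 < b j ∧ b j < 1)
    (hsa : ∑ i ∈ Finset.range 2, a i = 1) (hsb : ∑ j ∈ Finset.range 2, b j = 1)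
    (α : ℝ) (hα1 : -Real.log (sOne 2 2 a b) < α) (hα2 : α < -Real.log (sTwo 2 2 a b))
    (qa qb : ℝ) (hqa : HasDerivAt (theta 2 a) (-α) qa) (hqb : HasDerivAt (theta 2 b) (-α) qb)
    (μt : Measure (Omg 2 2 T)) [IsProbabilityMeasure μt]
    (hμt : ∀ (n : ℕ) (w : Word 2 2 T n),
      μt (cyl 2 2 T n w) = ENNReal.ofReal (cylWeight 2 2 T (taW 2 a qa) (taW 2 b qb) n w)) :
    ∀ᵐ x ∂(μt.map (gammaMap 2 2 T)),
      Filter.liminf (fun n : ℕ =>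
          Real.logb 2 (μt.map (gammaMap 2 2 T) (Idyad n x)).toReal / (-(n : ℝ))) atTop =
        min (hEnt (taW 2 a qa)) (hEnt (taW 2 b qb)) ∧
      Filter.limsup (fun n : ℕ =>
          Real.logb 2 (μt.map (gammaMap 2 2 T) (Idyad n x)).toReal / (-(n : ℝ))) atTop =
        max (hEnt (taW 2 a qa)) (hEnt (taW 2 b qb)) := by
  obtain ⟨δa, hδa, hwa⟩ := exists_isWeight_taW ha qa
  obtain ⟨δb, hδb, hwb⟩ := exists_isWeight_taW hb qb
  set p := taW 2 a qa
  set r := taW 2 b qb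
  have hδ : 0 < min δa δb := lt_min hδa hδb
  replace hwa := hwa.mono (min_le_left δa δb)
  replace hwb := hwb.mono (min_le_right δa δb)
  have hmeas := measurable_logb_map_Idyad (μt.map (gammaMap 2 2 T))
  refine (ae_map_iff (measurable_gammaMap T).aemeasurable
    ((measurableSet_eq_fun (Measurable.liminf hmeas) measurable_const).inter
      (measurableSet_eq_fun (Measurable.limsup hmeas) measurable_const))).2 ?_
  filter_upwards [ae_gammaMap_ne_dyadic hδ hwa hwb hμt,
    ae_tendsto_average_information hδ hwa hwb hμt] with x hx hlim
  set u : ℕ → ℝ := fun n => Real.logb 2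
    (μt.map (gammaMap 2 2 T) (Idyad n (gammaMap 2 2 T x))).toReal / (-(n : ℝ)) with hu
  set e : ℕ → ℝ := fun n => (∑ i ∈ Finset.range n,
    (-Real.logb 2 (siteWeight T p r i (x i).val) - hEnt (siteWeight T p r i))) / (n : ℝ) with he
  set E : ℕ → ℝ := fun i => if isA T (i + 1) then hEnt p else hEnt r with hE
  have hue : ∀ n, u n = (∑ i ∈ Finset.range n, E i) / n + e n := by
    intro n
    rw [hu, he]
    simp only [logb_map_gammaMap_Idyad hδ hwa hwb hμt (hx n), hEnt_siteWeight]
    rw [← add_div, ← Finset.sum_add_distrib, div_neg, ← neg_div, ← Finset.sum_neg_distrib]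
    simp [hE]
  obtain ⟨hA, hB⟩ := tendsto_average_ite_isA hT1 hTmono hTrat (hEnt p) (hEnt r)
  have hTtop : Tendsto T atTop atTop :=
    (tendsto_add_atTop_iff_nat 1).1 (block_strictMono hTmono).tendsto_atTop
  have hφ : Tendsto (fun k => T (2 * k + 2)) atTop atTop :=
    hTtop.comp (tendsto_atTop_mono (fun k => (by omega : k ≤ 2 * k + 2)) tendsto_id)
  have hψ : Tendsto (fun k => T (2 * k + 3)) atTop atTop :=
    hTtop.comp (tendsto_atTop_mono (fun k => (by omega : k ≤ 2 * k + 3)) tendsto_id)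
  have huA : Tendsto (u ∘ fun k => T (2 * k + 2)) atTop (𝓝 (hEnt p)) := by
    simpa [Function.comp_def, hue] using hA.add (hlim.comp hφ)
  have huB : Tendsto (u ∘ fun k => T (2 * k + 3)) atTop (𝓝 (hEnt r)) := by
    simpa [Function.comp_def, hue] using hB.add (hlim.comp hψ)
  have hlow : ∀ᶠ n in atTop, min (hEnt p) (hEnt r) + e n ≤ u n := by
    filter_upwards [eventually_gt_atTop 0] with n hn
    have hn' : (0 : ℝ) < n := by exact_mod_cast hn
    rw [hue, add_le_add_iff_right, le_div_iff₀ hn', mul_comm]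
    simpa using Finset.card_nsmul_le_sum (Finset.range n) E (min (hEnt p) (hEnt r))
      fun i _ => by simp only [hE]; split_ifs <;> simp
  have hup : ∀ᶠ n in atTop, u n ≤ max (hEnt p) (hEnt r) + e n := by
    filter_upwards [eventually_gt_atTop 0] with n hn
    have hn' : (0 : ℝ) < n := by exact_mod_cast hn
    rw [hue, add_le_add_iff_right, div_le_iff₀ hn', mul_comm]
    simpa using Finset.sum_le_card_nsmul (Finset.range n) E (max (hEnt p) (hEnt r))
      fun i _ => by simp only [hE]; split_ifs <;> simp
  have hlow' : ∀ᶠ n in atTop, min (hEnt p) (hEnt r) - 1 ≤ u n := by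
    filter_upwards [hlow, hlim.eventually (lt_mem_nhds neg_one_lt_zero)] with n h1 h2
    linarith
  have hup' : ∀ᶠ n in atTop, u n ≤ max (hEnt p) (hEnt r) + 1 := by
    filter_upwards [hup, hlim.eventually (gt_mem_nhds one_pos)] with n h1 h2
    linarith
  rcases le_total (hEnt p) (hEnt r) with h | h
  · rw [min_eq_left h, max_eq_right h] at *
    exact ⟨liminf_eq_of_tendsto_subseq hlim hlow hup' hφ huA,
      limsup_eq_of_tendsto_subseq hlim hup hlow' hψ huB⟩
  · rw [min_eq_right h, max_eq_left h] at *
    exact ⟨liminf_eq_of_tendsto_subseq hlim hlow hup' hψ huB,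
      limsup_eq_of_tendsto_subseq hlim hup hlow' hφ huA⟩

end MF
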